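/- Let t, r be integers with t ≥ r + 3 and m = C(t,r) − 4. Then the r-uniform hypergraph formed by taking the first m sets in the colex ordering of ℕ^(r) has the largest Lagrangian among all r-graphs on t vertices with m edges. -/

import Mathlib

open Finset

/-- The evaluation of the Lagrangian polynomial of a hypergraph on ℕ at a weighting `x`. -/
noncomputable def lagEvalN (E : Finset (Finset ℕ)) (x : ℕ → ℝ) : ℝ :=
  ∑ e ∈ E, ∏ i ∈ e, x i

/-- A legal weighting on ℕ: nonnegative, finitely supported, summing to 1. -/
def IsLegalN (x : ℕ → ℝ) : Prop :=
  (∀ i, 0 ≤ x i) ∧ ∃ s : Finset ℕ, (∀ i ∉ s, x i = 0) ∧ ∑ i ∈ s, x i = 1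

/-- The Lagrangian of a hypergraph on ℕ. -/
noncomputable def lagrangianN (E : Finset (Finset ℕ)) : ℝ :=
  sSup {v | ∃ x, IsLegalN x ∧ lagEvalN E x = v}


set_option maxHeartbeats 1000000 in
lemma coreB (a b c e Q V F2 F3 F4 : ℝ) (he : 0 < e) (hec : e ≤ c) (hcb : c ≤ b)
    (hD : c^2 < a*e) (hQ : 0 < Q) (hQV : Q ≤ e*V) (hF4 : 0 ≤ F4) (hF3 : V ≤ F3)
    (hF2 : Q + b*V ≤ F2)
    (hor : c = e ∨ (a-e)*(F2+2*c*F3+c^2*F4) ≤ Q*(b+2*c)) :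
    ∃ η, 0 ≤ η ∧ η ≤ e ∧ 0 ≤ η*(F2*(a+e-2*c)+2*F3*(a*e-c^2)+F4*(c*(2*a*e-c*(a+e))))
      - Q*(a*e-c^2) + η*Q*(a+b+2*c-e) + η^2*Q
      - η^2*(2*F2+(a+e+2*c)*F3+F4*(2*c*(a+e)-a*e-c^2)) + F4*(-η^3*(a+e-2*c)+η^4) := by
  have hc : 0 < c := by linarith
  have hb : 0 < b := by linarith
  have hV : 0 < V := by
    by_contra h
    have : e * V ≤ 0 := mul_nonpos_of_nonneg_of_nonpos he.le (not_lt.mp h)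
    linarith
  have hac : c < a := by
    by_contra h
    nlinarith
  have hσ : 0 ≤ a + e - 2*c := by
    by_contra h
    nlinarith [sq_nonneg (a-e)]
  obtain ⟨m, hm⟩ : ∃ m, m = (a+e+2*c)/4 := ⟨_, rfl⟩
  have hmc : c ≤ m := by linarith
  have hm0 : 0 < m := by linarith
  have hF20 : 0 < F2 := by nlinarith
  have hF30 : 0 < F3 := by linarith
  obtain ⟨W, hW⟩ : ∃ W, W = F2+2*m*F3+m*c*F4 := ⟨_, rfl⟩
  have hmc4 : 0 ≤ m*c*F4 := by positivity
  have hmF3 : 0 < m*F3 := by positivity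
  have hW0 : 0 < W := by rw [hW]; linarith
  obtain ⟨η, hη⟩ : ∃ η, η = Q*m/W := ⟨_, rfl⟩
  have hη0 : 0 < η := by rw [hη]; positivity
  have hηW : η*W = Q*m := by rw [hη]; field_simp
  have hQeq : Q = η*W/m := by rw [hηW]; field_simp
  have hηe : η ≤ e := by
    by_contra h
    push Not at h
    have h1 : e*W < η*W := mul_lt_mul_of_pos_right h hW0
    have h2 : e*(2*m*V) ≤ e*W := by
      apply mul_le_mul_of_nonneg_left _ he.le
      rw [hW]; nlinarith
    nlinarith
  refine ⟨η, hη0.le, hηe, ?_⟩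
  have hs1 : F4*η*c ≤ Q := by
    have : F4*η*c*m ≤ Q*m := by
      rw [← hηW, hW]
      have : 0 ≤ η*(F2+2*m*F3) := by positivity
      nlinarith
    exact le_of_mul_le_mul_right this hm0
  have hs2 : F4*η*(a+e-2*c) ≤ 2*V*(2*m-e) + 2*Q := by
    have h1 : F4*η*(a+e-2*c)*c ≤ Q*(a+e-2*c) := by nlinarith
    have h0 : 0 ≤ F4*η*(a+e-2*c) := by positivity
    have h2 : F4*η*(a+e-2*c)*e ≤ Q*(a+e-2*c) := by nlinarith
    have h3 : Q*(a+e-2*c) ≤ (2*V*(2*m-e) + 2*Q)*e := by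
      have : Q*(2*m-e) ≤ e*V*(2*m-e) := mul_le_mul_of_nonneg_right hQV (by linarith)
      have : Q*(a+e-2*c) ≤ Q*(4*m) := mul_le_mul_of_nonneg_left (by linarith) hQ.le
      linarith
    exact le_of_mul_le_mul_right (h2.trans h3) he
  have hs3 : F4*η*(a+e-2*c) ≤ 2*F3*(2*m+b-2*e) + F2*(2*m+b-2*e)/m := by
    have h1 : F2 ≤ F2*(2*m+b-2*e)/m := by
      rw [le_div_iff₀ hm0]
      apply mul_le_mul_of_nonneg_left _ hF20.le
      linarith
    have h2 : 2*V*(2*m-e) ≤ 2*F3*(2*m+b-2*e) := by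
      have := mul_le_mul hF3 (show 2*m-e ≤ 2*m+b-2*e by linarith) (by linarith) hF30.le
      linarith
    have h3 : 2*Q ≤ F2 := by nlinarith
    linarith
  have hs4 : 0 ≤ η*(4*c^2-3*c*e-a*(c-e)+c*(b-c)) - c*(a-c)*(c-e) := by
    rcases hor with h | h
    · subst h
      have : 0 ≤ η*(c^2 + c*(b-c)) := by
        have : 0 ≤ c*(b-c) := mul_nonneg hc.le (by linarith)
        positivity
      nlinarith
    · obtain ⟨E, hE⟩ : ∃ E, E = F2+2*c*F3+c^2*F4 := ⟨_, rfl⟩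
      rw [← hE] at h
      have hEV : (b+2*c)*V ≤ E := by
        rw [hE]
        have : 0 ≤ c^2*F4 := by positivity
        nlinarith
      have hE0 : 0 < E := by
        have : 0 < (b+2*c)*V := by positivity
        linarith
      have hθe : a - e ≤ e := by
        by_contra h'
        push Not at h'
        have h1 : e*((b+2*c)*V) < (a-e)*E := by
          have : e*((b+2*c)*V) ≤ e*E := mul_le_mul_of_nonneg_left hEV he.le
          have : e*E < (a-e)*E := mul_lt_mul_of_pos_right h' hE0
          linarith
        have h2 : Q*(b+2*c) ≤ e*V*(b+2*c) := mul_le_mul_of_nonneg_right hQV (by linarith)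
        linarith
      have hηE : Q*c ≤ η*E := by
        have h1 : W*c ≤ E*m := by
          have := mul_le_mul_of_nonneg_left hmc hF20.le
          rw [hW, hE]; linarith
        have h2 : η*(W*c) ≤ η*(E*m) := mul_le_mul_of_nonneg_left h1 hη0.le
        have h3 : (Q*c)*m ≤ (η*E)*m := by
          calc (Q*c)*m = η*(W*c) := by rw [← mul_assoc, hηW]; ring
            _ ≤ _ := by linarith
        exact le_of_mul_le_mul_right h3 hm0
      have hηθ : (a-e)*c ≤ η*(b+2*c) := by
        have : ((a-e)*c)*E ≤ (η*(b+2*c))*E := by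
          have h1 : (a-e)*E*c ≤ Q*(b+2*c)*c := mul_le_mul_of_nonneg_right h hc.le
          have h2 : Q*c*(b+2*c) ≤ η*E*(b+2*c) := mul_le_mul_of_nonneg_right hηE (by linarith)
          linarith
        exact le_of_mul_le_mul_right this hE0
      have hT : (a-e)*(b+2*c)/4 ≤ 4*c^2-3*c*e-a*(c-e)+c*(b-c) := by
        have h1 : (a-e)*(b+2*c) ≤ e*(b+2*c) := mul_le_mul_of_nonneg_right hθe (by linarith)
        have h2 : e*(b-c) ≤ c*(b-c) := mul_le_mul_of_nonneg_right hec (by linarith)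
        have h3 : a*(c-e) ≤ 2*e*(c-e) := mul_le_mul_of_nonneg_right (by linarith) (by linarith)
        nlinarith [sq_nonneg (c-e), mul_nonneg he.le (sub_nonneg.2 hec)]
      have h5 : η*((a-e)*(b+2*c)/4) ≤ η*(4*c^2-3*c*e-a*(c-e)+c*(b-c)) :=
        mul_le_mul_of_nonneg_left hT hη0.le
      have h6 : (a-e)*((a-e)*c) ≤ (a-e)*(η*(b+2*c)) :=
        mul_le_mul_of_nonneg_left hηθ (by linarith)
      have h7 : c*((a-c)*(c-e)) ≤ c*((a-e)^2/4) := by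
        apply mul_le_mul_of_nonneg_left _ hc.le
        nlinarith [sq_nonneg (a-c-(c-e))]
      linarith
  have hfin : η*(F2*(a+e-2*c)+2*F3*(a*e-c^2)+F4*(c*(2*a*e-c*(a+e))))
      - Q*(a*e-c^2) + η*Q*(a+b+2*c-e) + η^2*Q
      - η^2*(2*F2+(a+e+2*c)*F3+F4*(2*c*(a+e)-a*e-c^2)) + F4*(-η^3*(a+e-2*c)+η^4)
      = η*F2*((a-e)^2/4)/m
        + η*F4*(η*(4*c^2-3*c*e-a*(c-e)+c*(b-c)) - c*(a-c)*(c-e))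
        + η^2*(2*F3*(2*m+b-2*e) + F2*(2*m+b-2*e)/m - F4*η*(a+e-2*c))
        + η^2*Q + F4*η^4 := by
    have ha : a = 4*m - e - 2*c := by linarith
    have e1 : - Q*(a*e-c^2) + η*Q*(a+b+2*c-e) = η*W/m*(-(a*e-c^2) + η*(a+b+2*c-e)) := by
      rw [← hQeq]; ring
    have e2 : η*(F2*(a+e-2*c)+2*F3*(a*e-c^2)+F4*(c*(2*a*e-c*(a+e))))
      - Q*(a*e-c^2) + η*Q*(a+b+2*c-e) + η^2*Q
      - η^2*(2*F2+(a+e+2*c)*F3+F4*(2*c*(a+e)-a*e-c^2)) + F4*(-η^3*(a+e-2*c)+η^4) =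
      η*(F2*(a+e-2*c)+2*F3*(a*e-c^2)+F4*(c*(2*a*e-c*(a+e))))
      + η*W/m*(-(a*e-c^2) + η*(a+b+2*c-e)) + η^2*Q
      - η^2*(2*F2+(a+e+2*c)*F3+F4*(2*c*(a+e)-a*e-c^2)) + F4*(-η^3*(a+e-2*c)+η^4) := by
      rw [← e1]; ring
    rw [e2, hW, ha]
    field_simp
    ring
  rw [hfin]
  have t1 : 0 ≤ η*F2*((a-e)^2/4)/m := by positivity
  have t2 : 0 ≤ η*F4*(η*(4*c^2-3*c*e-a*(c-e)+c*(b-c)) - c*(a-c)*(c-e)) :=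
    mul_nonneg (by positivity) hs4
  have t3 : 0 ≤ η^2*(2*F3*(2*m+b-2*e) + F2*(2*m+b-2*e)/m - F4*η*(a+e-2*c)) :=
    mul_nonneg (by positivity) (by linarith)
  have t4 : 0 ≤ η^2*Q := by positivity
  have t5 : 0 ≤ F4*η^4 := by positivity
  linarith

/-- The complete part: `∑ k, e_k(a,b,c,d,e,f) * g k`. -/
def fullP (g : ℕ → ℝ) (a b c d e f : ℝ) : ℝ :=
  g 0 + (a+b+c+d+e+f) * g 1
  + (a*b+(a+b)*(c+d+e+f)+(c*d+c*e+c*f+d*e+d*f+e*f)) * g 2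
  + (a*b*(c+d+e+f)+(a+b)*(c*d+c*e+c*f+d*e+d*f+e*f)+(c*d*e+c*d*f+c*e*f+d*e*f)) * g 3
  + (a*b*(c*d+c*e+c*f+d*e+d*f+e*f)+(a+b)*(c*d*e+c*d*f+c*e*f+d*e*f)+c*d*e*f) * g 4
  + (a*b*(c*d*e+c*d*f+c*e*f+d*e*f)+(a+b)*(c*d*e*f)) * g 5
  + a*b*c*d*e*f * g 6

def valA (g : ℕ → ℝ) (V a b c d e f : ℝ) : ℝ :=
  fullP g a b c d e f - V*f*e*(a+b+c+d)
def valB (g : ℕ → ℝ) (V a b c d e f : ℝ) : ℝ :=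
  fullP g a b c d e f - V*f*(e*(b+c+d)+c*d)
def valC (g : ℕ → ℝ) (V a b c d e f : ℝ) : ℝ :=
  fullP g a b c d e f - V*(d*e*f+c*e*f+c*d*f+c*d*e)

lemma valC_avg (g : ℕ → ℝ) (V a b c d e f : ℝ) (hg : ∀ k, 0 ≤ g k) (hV : V ≤ g 3)
    (ha : 0 ≤ a) (hb : 0 ≤ b) (he : 0 ≤ e) (hf : 0 ≤ f) :
    valC g V a b c d e f ≤ valC g V a b ((c+d)/2) ((c+d)/2) e f := by
  have h2 := hg 2
  have h3 := hg 3
  have h4 := hg 4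
  have h5 := hg 5
  have h6 := hg 6
  have key : valC g V a b ((c+d)/2) ((c+d)/2) e f - valC g V a b c d e f =
      ((c-d)/2)^2 * (g 2 + (a+b)*g 3 + (e+f)*(g 3 - V) + (a*b+(a+b)*(e+f)+e*f)*g 4
        + (a*b*(e+f)+(a+b)*(e*f))*g 5 + a*b*e*f*g 6) := by
    unfold valC fullP; ring
  have : 0 ≤ (e+f)*(g 3 - V) := mul_nonneg (by linarith) (by linarith)
  have h := sq_nonneg ((c-d)/2)
  have : 0 ≤ ((c-d)/2)^2 * (g 2 + (a+b)*g 3 + (e+f)*(g 3 - V) + (a*b+(a+b)*(e+f)+e*f)*g 4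
        + (a*b*(e+f)+(a+b)*(e*f))*g 5 + a*b*e*f*g 6) := by positivity
  linarith

lemma valC_avg_ab (g : ℕ → ℝ) (V a b c d e f : ℝ) (hg : ∀ k, 0 ≤ g k)
    (hc : 0 ≤ c) (hd : 0 ≤ d) (he : 0 ≤ e) (hf : 0 ≤ f) :
    valC g V a b c d e f ≤ valC g V ((a+b)/2) ((a+b)/2) c d e f := by
  have h2 := hg 2
  have h3 := hg 3
  have h4 := hg 4
  have h5 := hg 5
  have h6 := hg 6
  have key : valC g V ((a+b)/2) ((a+b)/2) c d e f - valC g V a b c d e f =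
      ((a-b)/2)^2 * (g 2 + (c+d+e+f)*g 3 + (c*d+c*e+c*f+d*e+d*f+e*f)*g 4
        + (c*d*e+c*d*f+c*e*f+d*e*f)*g 5 + c*d*e*f*g 6) := by
    unfold valC fullP; ring
  have : 0 ≤ ((a-b)/2)^2 * (g 2 + (c+d+e+f)*g 3 + (c*d+c*e+c*f+d*e+d*f+e*f)*g 4
        + (c*d*e+c*d*f+c*e*f+d*e*f)*g 5 + c*d*e*f*g 6) := by positivity
  linarith

lemma valC_sym (g : ℕ → ℝ) (V a b c d e f : ℝ) :
    valC g V a b c d e f = valC g V a b c e d f ∧ valC g V a b c d e f = valC g V a b e f c d := by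
  constructor <;> (unfold valC fullP; ring)

lemma valC_avg_all (g : ℕ → ℝ) (V a b c d e f : ℝ) (hg : ∀ k, 0 ≤ g k) (hV : V ≤ g 3)
    (ha : 0 ≤ a) (hb : 0 ≤ b) (hc : 0 ≤ c) (hd : 0 ≤ d) (he : 0 ≤ e) (hf : 0 ≤ f) :
    valC g V a b c d e f ≤ valC g V ((a+b)/2) ((a+b)/2) ((c+d+e+f)/4) ((c+d+e+f)/4)
      ((c+d+e+f)/4) ((c+d+e+f)/4) := by
  have s1 := valC_avg_ab g V a b c d e f hg hc hd he hf
  obtain ⟨A, hA⟩ : ∃ A, A = (a+b)/2 := ⟨_, rfl⟩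
  rw [← hA] at s1 ⊢
  have hA0 : 0 ≤ A := by rw [hA]; positivity
  have s2 := valC_avg g V A A c d e f hg hV hA0 hA0 he hf
  obtain ⟨u, hu⟩ : ∃ u, u = (c+d)/2 := ⟨_, rfl⟩
  obtain ⟨v, hv⟩ : ∃ v, v = (e+f)/2 := ⟨_, rfl⟩
  rw [← hu] at s2
  have hu0 : 0 ≤ u := by rw [hu]; positivity
  have hv0 : 0 ≤ v := by rw [hv]; positivity
  rw [(valC_sym g V A A u u e f).2] at s2
  have s3 := valC_avg g V A A e f u u hg hV hA0 hA0 hu0 hu0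
  rw [← hv] at s3
  rw [(valC_sym g V A A v v u u).1] at s3
  have s4 := valC_avg g V A A v u v u hg hV hA0 hA0 hv0 hu0
  obtain ⟨w, hw⟩ : ∃ w, w = (v+u)/2 := ⟨_, rfl⟩
  rw [← hw] at s4
  have hw0 : 0 ≤ w := by rw [hw]; positivity
  rw [(valC_sym g V A A w w v u).2] at s4
  have s5 := valC_avg g V A A v u w w hg hV hA0 hA0 hw0 hw0
  rw [← hw] at s5
  have : (c+d+e+f)/4 = w := by rw [hw, hu, hv]; ring
  rw [this]
  linarith

/-- Derivative test at a maximum on `[0, μ]`. -/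
lemma deriv_nonneg_of_max (φ : ℝ → ℝ) (φ' μ δ : ℝ) (hd : HasDerivAt φ φ' δ) (h0 : 0 < δ)
    (h1 : δ ≤ μ) (hmax : ∀ y ∈ Set.Icc 0 μ, φ y ≤ φ δ) : 0 ≤ φ' := by
  have ht := (hasDerivAt_iff_tendsto_slope_left_right.1 hd).1
  refine ge_of_tendsto ht ?_
  have : Set.Ioo 0 δ ∈ nhdsWithin δ (Set.Iio δ) := Ioo_mem_nhdsLT h0
  filter_upwards [this] with y hy
  rw [slope_def_field]
  exact div_nonneg_of_nonpos (by linarith [hmax y ⟨hy.1.le, by linarith [hy.2]⟩])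
    (by linarith [hy.2])

set_option maxHeartbeats 1000000 in
lemma lemC1 (g : ℕ → ℝ) (V μ δ : ℝ) (hg : ∀ k, 0 ≤ g k) (hV0 : 0 < V) (hV : V ≤ g 3)
    (hδ : 0 ≤ δ) (hδμ : δ ≤ μ)
    (hG : δ*(g 2 + (4*μ-δ)*g 3 + 3*(μ-δ)*(2*μ+δ)*g 4 + (μ-δ)^2*(4*μ+5*δ)*g 5
      + (μ-δ)^3*(μ+2*δ)*g 6) ≤ (μ-δ)^2*V) :
    δ ≤ μ/5 ∧ valC g V (μ+2*δ) (μ+2*δ) (μ-δ) (μ-δ) (μ-δ) (μ-δ) ≤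
      valA g V (μ+δ) (μ+δ) (μ+δ) (μ+δ) (μ-2*δ) (μ-2*δ) := by
  have h2 := hg 2
  have h3 := hg 3
  have h4 := hg 4
  have h5 := hg 5
  have h6 := hg 6
  have hμ : 0 ≤ μ := by linarith
  have hu : 0 ≤ μ - δ := by linarith
  obtain ⟨G, hGd⟩ : ∃ G, G = g 2 + (4*μ-δ)*g 3 + 3*(μ-δ)*(2*μ+δ)*g 4 + (μ-δ)^2*(4*μ+5*δ)*g 5
      + (μ-δ)^3*(μ+2*δ)*g 6 := ⟨_, rfl⟩
  rw [← hGd] at hG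
  have hG1 : (4*μ-δ)*V ≤ G := by
    have : (4*μ-δ)*V ≤ (4*μ-δ)*g 3 := mul_le_mul_of_nonneg_left hV (by linarith)
    have : 0 ≤ 3*(μ-δ)*(2*μ+δ)*g 4 := by positivity
    have : 0 ≤ (μ-δ)^2*(4*μ+5*δ)*g 5 := by positivity
    have : 0 ≤ (μ-δ)^3*(μ+2*δ)*g 6 := by positivity
    linarith
  have hδ5 : δ ≤ μ/5 := by
    by_contra h
    push Not at h
    have k1 : δ*((4*μ-δ)*V) ≤ δ*G := mul_le_mul_of_nonneg_left hG1 hδ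
    have k2 : (δ*(4*μ-δ))*V ≤ (μ-δ)^2*V := by linarith
    have k3 := le_of_mul_le_mul_right k2 hV0
    nlinarith
  refine ⟨hδ5, ?_⟩
  rcases hδ.eq_or_lt with h | hδ0
  · subst h
    unfold valC valA fullP
    ring_nf
    rfl
  have hμ0 : 0 < μ := by linarith
  have hu0 : 0 < μ - δ := by linarith
  obtain ⟨H, hH⟩ : ∃ H, H = g 3 + 3*μ*g 4 + 3*(μ^2-δ^2)*g 5 + (μ^3-3*μ*δ^2)*g 6 := ⟨_, rfl⟩
  have key : valA g V (μ+δ) (μ+δ) (μ+δ) (μ+δ) (μ-2*δ) (μ-2*δ)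
      - valC g V (μ+2*δ) (μ+2*δ) (μ-δ) (μ-δ) (μ-δ) (μ-δ)
      = 4*δ^2*(V*(3*μ-5*δ) - 2*δ*H) := by
    rw [hH]; unfold valC valA fullP; ring
  have main : 2*H*(μ-δ)^2 ≤ (3*μ-5*δ)*G := by
    have c3 : 0 ≤ ((3*μ-5*δ)*(4*μ-δ) - 2*(μ-δ)^2) * g 3 := mul_nonneg (by nlinarith) h3
    have c4 : 0 ≤ (3*(μ-δ)*((3*μ-5*δ)*(2*μ+δ) - 2*μ*(μ-δ))) * g 4 := by
      have : 0 ≤ (3*μ-5*δ)*(2*μ+δ) - 2*μ*(μ-δ) := by nlinarith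
      positivity
    have c5 : 0 ≤ ((μ-δ)^2*((3*μ-5*δ)*(4*μ+5*δ) - 6*(μ^2-δ^2))) * g 5 := by
      have : 0 ≤ (3*μ-5*δ)*(4*μ+5*δ) - 6*(μ^2-δ^2) := by nlinarith
      positivity
    have c6 : 0 ≤ ((μ-δ)^2*((3*μ-5*δ)*(μ-δ)*(μ+2*δ) - 2*(μ^3-3*μ*δ^2))) * g 6 := by
      have : 0 ≤ (3*μ-5*δ)*(μ-δ)*(μ+2*δ) - 2*(μ^3-3*μ*δ^2) := by
        have e : (3*μ-5*δ)*(μ-δ)*(μ+2*δ) - 2*(μ^3-3*μ*δ^2)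
          = μ^2*(μ-2*δ) - 5*μ*δ^2 + 10*δ^3 := by ring
        have : 5*μ*δ^2 ≤ μ^2*(μ-2*δ) := by
          have q1 : μ*(5*δ^2) ≤ μ*(μ*(μ-2*δ)) :=
            mul_le_mul_of_nonneg_left (by nlinarith) hμ
          linarith
        have : 0 ≤ 10*δ^3 := by positivity
        linarith
      positivity
    have c2 : 0 ≤ (3*μ-5*δ)*g 2 := mul_nonneg (by linarith) h2
    rw [hH, hGd]
    linarith
  have m2 : (2*δ*H)*(μ-δ)^2 ≤ (V*(3*μ-5*δ))*(μ-δ)^2 := by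
    have a1 : δ*(2*H*(μ-δ)^2) ≤ δ*((3*μ-5*δ)*G) := mul_le_mul_of_nonneg_left main hδ
    have a2 : (3*μ-5*δ)*(δ*G) ≤ (3*μ-5*δ)*((μ-δ)^2*V) :=
      mul_le_mul_of_nonneg_left hG (by linarith)
    linarith
  have m3 := le_of_mul_le_mul_right m2 (by positivity)
  have : 0 ≤ 4*δ^2*(V*(3*μ-5*δ) - 2*δ*H) := mul_nonneg (by positivity) (by linarith)
  linarith

set_option maxHeartbeats 1000000 in
lemma lemC (g : ℕ → ℝ) (V a b c d e f : ℝ) (hg : ∀ k, 0 ≤ g k) (hV0 : 0 < V) (hV : V ≤ g 3)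
    (hab : b ≤ a) (hbc : c ≤ b) (hcd : d ≤ c) (hde : e ≤ d) (hef : f ≤ e) (hf : 0 ≤ f) :
    ∃ a' b' c' d' e' f', 0 ≤ a' ∧ 0 ≤ b' ∧ 0 ≤ c' ∧ 0 ≤ d' ∧ 0 ≤ e' ∧ 0 ≤ f' ∧
      a'+b'+c'+d'+e'+f' = a+b+c+d+e+f ∧ valC g V a b c d e f ≤ valA g V a' b' c' d' e' f' := by
  have s1 := valC_avg_all g V a b c d e f hg hV (by linarith) (by linarith) (by linarith)
    (by linarith) (by linarith) hf
  obtain ⟨μ, hμ⟩ : ∃ μ, μ = (a+b+c+d+e+f)/6 := ⟨_, rfl⟩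
  obtain ⟨δ₀, hδ₀⟩ : ∃ δ₀, δ₀ = μ - (c+d+e+f)/4 := ⟨_, rfl⟩
  have e1 : (a+b)/2 = μ+2*δ₀ := by rw [hδ₀, hμ]; ring
  have e2 : (c+d+e+f)/4 = μ-δ₀ := by rw [hδ₀]; ring
  rw [e1, e2] at s1
  have hδ0 : 0 ≤ δ₀ := by rw [hδ₀, hμ]; linarith
  have hδμ : δ₀ ≤ μ := by rw [hδ₀]; linarith
  let φ : ℝ → ℝ := fun δ => valC g V (μ+2*δ) (μ+2*δ) (μ-δ) (μ-δ) (μ-δ) (μ-δ)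
  have hφ : ∀ δ, φ δ = g 0 + 6*μ*g 1 + (15*μ^2-6*δ^2)*g 2 + (20*μ^3-24*μ*δ^2+4*δ^3)*g 3
      + (15*μ^4-36*μ^2*δ^2+12*μ*δ^3+9*δ^4)*g 4
      + (6*μ^5-24*μ^3*δ^2+12*μ^2*δ^3+18*μ*δ^4-12*δ^5)*g 5
      + (μ^6-6*μ^4*δ^2+4*μ^3*δ^3+9*μ^2*δ^4-12*μ*δ^5+4*δ^6)*g 6
      - 4*V*(μ^3-3*μ^2*δ+3*μ*δ^2-δ^3) := by
    intro δ; simp only [φ]; unfold valC fullP; ring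
  have hder : ∀ δ, HasDerivAt φ (12*((μ-δ)^2*V - δ*(g 2 + (4*μ-δ)*g 3 + 3*(μ-δ)*(2*μ+δ)*g 4
      + (μ-δ)^2*(4*μ+5*δ)*g 5 + (μ-δ)^3*(μ+2*δ)*g 6))) δ := by
    intro δ
    have p : ∀ n : ℕ, HasDerivAt (fun y : ℝ => y^(n+1)) ((n+1:ℕ)*δ^n) δ := fun n => by
      simpa using hasDerivAt_pow (n+1) δ
    have d1 := hasDerivAt_id δ
    have d2 := p 1
    have d3 := p 2
    have d4 := p 3
    have d5 := p 4
    have d6 := p 5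
    simp only [Nat.reduceAdd] at d2 d3 d4 d5 d6
    have k2 := (d2.const_mul (-6)).mul_const (g 2)
    have k3 := (((d2.const_mul (-24*μ)).add (d3.const_mul 4))).mul_const (g 3)
    have k4 := (((d2.const_mul (-36*μ^2)).add (d3.const_mul (12*μ))).add (d4.const_mul 9)).mul_const (g 4)
    have k5 := ((((d2.const_mul (-24*μ^3)).add (d3.const_mul (12*μ^2))).add (d4.const_mul (18*μ))).add
      (d5.const_mul (-12))).mul_const (g 5)
    have k6 := (((((d2.const_mul (-6*μ^4)).add (d3.const_mul (4*μ^3))).add (d4.const_mul (9*μ^2))).add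
      (d5.const_mul (-12*μ))).add (d6.const_mul 4)).mul_const (g 6)
    have k1 := ((((d1.const_mul (-3*μ^2)).add (d2.const_mul (3*μ))).add (d3.const_mul (-1))).const_mul (-4*V))
    have kk := (((((k1.add k2).add k3).add k4).add k5).add k6).const_add
      (g 0 + 6*μ*g 1 + 15*μ^2*g 2 + 20*μ^3*g 3 + 15*μ^4*g 4 + 6*μ^5*g 5 + μ^6*g 6 - 4*V*μ^3)
    refine (kk.congr_of_eventuallyEq (Filter.Eventually.of_forall fun y => ?_)).congr_deriv ?_
    · rw [hφ]; simp only [Pi.add_apply, id]; ring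
    · push_cast; ring
  obtain ⟨δ, hδm, hmax⟩ := (isCompact_Icc (a := (0:ℝ)) (b := μ)).exists_isMaxOn
    ⟨δ₀, hδ0, hδμ⟩ (f := φ) (fun y _ => (hder y).continuousAt.continuousWithinAt)
  have hG : δ*(g 2 + (4*μ-δ)*g 3 + 3*(μ-δ)*(2*μ+δ)*g 4 + (μ-δ)^2*(4*μ+5*δ)*g 5
      + (μ-δ)^3*(μ+2*δ)*g 6) ≤ (μ-δ)^2*V := by
    rcases hδm.1.eq_or_lt with h | h
    · rw [← h]; simp only [zero_mul]; positivity
    · have := deriv_nonneg_of_max φ _ μ δ (hder δ) h hδm.2 (fun y hy => hmax hy)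
      linarith
  obtain ⟨h5, hle⟩ := lemC1 g V μ δ hg hV0 hV hδm.1 hδm.2 hG
  have h0 := hδm.1
  refine ⟨μ+δ, μ+δ, μ+δ, μ+δ, μ-2*δ, μ-2*δ, by linarith, by linarith, by linarith, by linarith,
    by linarith, by linarith, by rw [hμ]; ring, ?_⟩
  have : φ δ₀ ≤ φ δ := hmax ⟨hδ0, hδμ⟩
  simp only [φ] at this
  linarith

/-- after averaging and balancing -/
lemma lemB1 (g : ℕ → ℝ) (V a b c e f : ℝ) (hg : ∀ k, 0 ≤ g k) (hV0 : 0 < V) (hV : V ≤ g 3)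
    (hbc : c ≤ b) (hec : e ≤ c) (hea : e ≤ a) (hfe : f ≤ e) (hf : 0 < f)
    (hor : c = e ∨ (a-e)*((g 2 + (b+f)*g 3 + b*f*g 4)+2*c*(g 3 + (b+f)*g 4 + b*f*g 5)
      +c^2*(g 4 + (b+f)*g 5 + b*f*g 6)) ≤ V*f*(b+2*c)) :
    ∃ a' b' c' d' e' f', 0 ≤ a' ∧ 0 ≤ b' ∧ 0 ≤ c' ∧ 0 ≤ d' ∧ 0 ≤ e' ∧ 0 ≤ f' ∧
      a'+b'+c'+d'+e'+f' = a+b+c+c+e+f ∧ valB g V a b c c e f ≤ valA g V a' b' c' d' e' f' := by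
  have h2 := hg 2
  have h3 := hg 3
  have h4 := hg 4
  have h5 := hg 5
  have h6 := hg 6
  have he : 0 < e := by linarith
  have hc : 0 < c := by linarith
  have hb : 0 < b := by linarith
  by_cases hD : a*e ≤ c^2
  · refine ⟨a, b, c, c, e, f, by linarith, hb.le, hc.le, hc.le, he.le, hf.le, rfl, ?_⟩
    have : valA g V a b c c e f - valB g V a b c c e f = V*f*(c^2-a*e) := by
      unfold valA valB; ring
    have : 0 ≤ V*f*(c^2-a*e) := mul_nonneg (by positivity) (by linarith)
    linarith
  push Not at hD
  obtain ⟨η, hη0, hηe, hΔ⟩ := coreB a b c e (V*f) V (g 2 + (b+f)*g 3 + b*f*g 4)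
    (g 3 + (b+f)*g 4 + b*f*g 5) (g 4 + (b+f)*g 5 + b*f*g 6) he hec hbc hD (by positivity)
    (by nlinarith) (by positivity)
    (by
      have : 0 ≤ (b+f)*g 4 + b*f*g 5 := by positivity
      linarith)
    (by
      have : 0 ≤ b*f*g 4 := by positivity
      have : (b+f)*V ≤ (b+f)*g 3 := mul_le_mul_of_nonneg_left hV (by linarith)
      linarith) hor
  refine ⟨a-η, b, c+η, c+η, e-η, f, by linarith, hb.le, by linarith, by linarith, by linarith,
    hf.le, by ring, ?_⟩
  have key : valA g V (a-η) b (c+η) (c+η) (e-η) f - valB g V a b c c e f =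
    η*((g 2 + (b+f)*g 3 + b*f*g 4)*(a+e-2*c)+2*(g 3 + (b+f)*g 4 + b*f*g 5)*(a*e-c^2)
      +(g 4 + (b+f)*g 5 + b*f*g 6)*(c*(2*a*e-c*(a+e))))
      - V*f*(a*e-c^2) + η*(V*f)*(a+b+2*c-e) + η^2*(V*f)
      - η^2*(2*(g 2 + (b+f)*g 3 + b*f*g 4)+(a+e+2*c)*(g 3 + (b+f)*g 4 + b*f*g 5)
        +(g 4 + (b+f)*g 5 + b*f*g 6)*(2*c*(a+e)-a*e-c^2))
      + (g 4 + (b+f)*g 5 + b*f*g 6)*(-η^3*(a+e-2*c)+η^4) := by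
    unfold valA valB fullP; ring
  linarith

lemma valB_avg (g : ℕ → ℝ) (V a b c d e f : ℝ) (hg : ∀ k, 0 ≤ g k) (hV : V ≤ g 3)
    (ha : 0 ≤ a) (hb : 0 ≤ b) (he : 0 ≤ e) (hf : 0 ≤ f) :
    valB g V a b c d e f ≤ valB g V a b ((c+d)/2) ((c+d)/2) e f := by
  have h2 := hg 2
  have h3 := hg 3
  have h4 := hg 4
  have h5 := hg 5
  have h6 := hg 6
  have key : valB g V a b ((c+d)/2) ((c+d)/2) e f - valB g V a b c d e f =
      ((c-d)/2)^2 * (g 2 + (a+b+e)*g 3 + f*(g 3 - V) + (a*b+(a+b)*(e+f)+e*f)*g 4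
        + (a*b*(e+f)+(a+b)*(e*f))*g 5 + a*b*e*f*g 6) := by
    unfold valB fullP; ring
  have : 0 ≤ f*(g 3 - V) := mul_nonneg (by linarith) (by linarith)
  have : 0 ≤ ((c-d)/2)^2 * (g 2 + (a+b+e)*g 3 + f*(g 3 - V) + (a*b+(a+b)*(e+f)+e*f)*g 4
        + (a*b*(e+f)+(a+b)*(e*f))*g 5 + a*b*e*f*g 6) := by positivity
  linarith

lemma lemB (g : ℕ → ℝ) (V a b c d e f : ℝ) (hg : ∀ k, 0 ≤ g k) (hV0 : 0 < V) (hV : V ≤ g 3)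
    (hab : b ≤ a) (hbc : c ≤ b) (hcd : d ≤ c) (hde : e ≤ d) (hef : f ≤ e) (hf : 0 < f) :
    ∃ a' b' c' d' e' f', 0 ≤ a' ∧ 0 ≤ b' ∧ 0 ≤ c' ∧ 0 ≤ d' ∧ 0 ≤ e' ∧ 0 ≤ f' ∧
      a'+b'+c'+d'+e'+f' = a+b+c+d+e+f ∧ valB g V a b c d e f ≤ valA g V a' b' c' d' e' f' := by
  have s1 := valB_avg g V a b c d e f hg hV (by linarith) (by linarith) (by linarith) hf.le
  obtain ⟨u, hu⟩ : ∃ u, u = (c+d)/2 := ⟨_, rfl⟩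
  rw [← hu] at s1
  have hub : u ≤ b := by linarith
  have heu : e ≤ u := by linarith
  have h2 := hg 2
  have h3 := hg 3
  have h4 := hg 4
  have h5 := hg 5
  have h6 := hg 6
  have he : 0 < e := by linarith
  have hu0 : 0 < u := by linarith
  have hb : 0 < b := by linarith
  have h30 : 0 < g 3 := by linarith
  obtain ⟨E, hE⟩ : ∃ E, E = ((g 2 + (b+f)*g 3 + b*f*g 4)+2*u*(g 3 + (b+f)*g 4 + b*f*g 5)
      +u^2*(g 4 + (b+f)*g 5 + b*f*g 6)) := ⟨_, rfl⟩
  have hE0 : 0 < E := by rw [hE]; positivity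
  have move : ∀ h, 0 ≤ h → h*E ≤ (a-e)*E - V*f*(b+2*u) →
      valB g V a b c d e f ≤ valB g V (a-h) b u u (e+h) f := by
    intro h hh hle
    have key : valB g V (a-h) b u u (e+h) f - valB g V a b u u e f =
        h*((a-e)*E - V*f*(b+2*u) - h*E) := by
      rw [hE]; unfold valB fullP; ring
    have : 0 ≤ h*((a-e)*E - V*f*(b+2*u) - h*E) := mul_nonneg hh (by linarith)
    linarith
  have fin : ∀ h, 0 ≤ h → h*E ≤ (a-e)*E - V*f*(b+2*u) ∨ h = 0 → e + h ≤ u → e + h ≤ a - h →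
      (u = e+h ∨ (a-h-(e+h))*E ≤ V*f*(b+2*u)) →
      ∃ a' b' c' d' e' f', 0 ≤ a' ∧ 0 ≤ b' ∧ 0 ≤ c' ∧ 0 ≤ d' ∧ 0 ≤ e' ∧ 0 ≤ f' ∧
      a'+b'+c'+d'+e'+f' = a+b+c+d+e+f ∧ valB g V a b c d e f ≤ valA g V a' b' c' d' e' f' := by
    intro h hh hle h1 h2' h3'
    rw [hE] at h3'
    obtain ⟨a', b', c', d', e', f', p1, p2, p3, p4, p5, p6, p7, p8⟩ :=
      lemB1 g V (a-h) b u (e+h) f hg hV0 hV hub h1 h2' (by linarith) hf h3'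
    refine ⟨a', b', c', d', e', f', p1, p2, p3, p4, p5, p6, by rw [p7, hu]; ring, ?_⟩
    rcases hle with hle | hle
    · exact (move h hh hle).trans p8
    · subst hle
      simp only [sub_zero, add_zero] at p8
      exact s1.trans p8
  by_cases hθ : (a-e)*E ≤ V*f*(b+2*u)
  · exact fin 0 le_rfl (Or.inr rfl) (by linarith) (by linarith) (Or.inr (by simpa using hθ))
  push Not at hθ
  obtain ⟨h0, hh0⟩ : ∃ h0, h0 = ((a-e) - V*f*(b+2*u)/E)/2 := ⟨_, rfl⟩
  have hh0E : 2*h0*E = (a-e)*E - V*f*(b+2*u) := by rw [hh0]; field_simp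
  have hh0p : 0 < h0 := by
    by_contra h
    have : 2*h0*E ≤ 0 := mul_nonpos_of_nonpos_of_nonneg (by linarith) hE0.le
    linarith
  have hQ0 : 0 ≤ V*f*(b+2*u)/E := by positivity
  by_cases hc : e + h0 ≤ u
  · refine fin h0 hh0p.le (Or.inl ?_) hc (by linarith) (Or.inr ?_)
    · have : 0 < h0*E := by positivity
      linarith
    · linarith
  · push Not at hc
    refine fin (u-e) (by linarith) (Or.inl ?_) (by linarith) (by linarith) (Or.inl (by ring))
    have : (u-e)*E ≤ 2*h0*E := mul_le_mul_of_nonneg_right (by linarith) hE0.le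
    linarith


noncomputable def esZ (x : ℕ → ℝ) (s : Finset ℕ) (j : ℤ) : ℝ :=
  if j < 0 then 0 else ∑ S ∈ s.powersetCard j.toNat, ∏ i ∈ S, x i

lemma esZ_insert (x : ℕ → ℝ) (s : Finset ℕ) (i : ℕ) (hi : i ∉ s) (j : ℤ) :
    esZ x (insert i s) j = esZ x s j + x i * esZ x s (j-1) := by
  unfold esZ
  rcases lt_trichotomy j 0 with h | h | h
  · rw [if_pos h, if_pos h, if_pos (by omega)]; simp
  · subst h; simp
  · obtain ⟨m, rfl⟩ : ∃ m : ℕ, j = (m:ℤ) + 1 := ⟨(j-1).toNat, by omega⟩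
    rw [if_neg (by omega), if_neg (by omega), if_neg (by omega)]
    have e1 : ((m:ℤ)+1).toNat = m.succ := by omega
    have e2 : ((m:ℤ)+1-1).toNat = m := by omega
    rw [e1, e2, powersetCard_succ_insert hi, sum_union, sum_image, mul_sum]
    · congr 1
      apply sum_congr rfl
      intro S hS
      rw [prod_insert]
      intro h'
      exact hi ((mem_powersetCard.1 hS).1 h')
    · intro S hS T hT hST
      have h1 : i ∉ S := fun h' => hi ((mem_powersetCard.1 hS).1 h')
      have h2 : i ∉ T := fun h' => hi ((mem_powersetCard.1 hT).1 h')
      rw [← erase_insert h1, ← erase_insert h2]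
      rw [hST]
    · rw [disjoint_left]
      intro S hS hS'
      obtain ⟨T, _, rfl⟩ := mem_image.1 hS'
      exact hi ((mem_powersetCard.1 hS).1 (mem_insert_self _ _))

lemma esZ_nonneg (x : ℕ → ℝ) (hx : ∀ i, 0 ≤ x i) (s : Finset ℕ) (j : ℤ) : 0 ≤ esZ x s j := by
  unfold esZ
  split_ifs
  · exact le_rfl
  · exact sum_nonneg fun S _ => prod_nonneg fun i _ => hx i

lemma esZ_congr (x y : ℕ → ℝ) (s : Finset ℕ) (h : ∀ i ∈ s, x i = y i) (j : ℤ) :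
    esZ x s j = esZ y s j := by
  unfold esZ
  split_ifs
  · rfl
  · exact sum_congr rfl fun S hS => prod_congr rfl fun i hi => h i ((mem_powersetCard.1 hS).1 hi)

/-- The remaining vertices. -/
def restO (n k : ℕ) : Finset ℕ := Icc 1 n ∪ Icc (n+7) (n+k+6)

lemma Icc_eq (n k : ℕ) : Icc 1 (n+k+6) = insert (n+1) (insert (n+2) (insert (n+3) (insert (n+4)
    (insert (n+5) (insert (n+6) (restO n k)))))) := by
  ext i; simp only [restO, mem_Icc, mem_insert, mem_union]; omega

noncomputable def gO (x : ℕ → ℝ) (n k : ℕ) : ℕ → ℝ := fun j => esZ x (restO n k) ((k:ℤ)+3-j)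

noncomputable def Vp (x : ℕ → ℝ) (n k : ℕ) : ℝ := ∏ i ∈ Icc (n+7) (n+k+6), x i

lemma full_eq (x : ℕ → ℝ) (n k : ℕ) :
    ∑ S ∈ (Icc 1 (n+k+6)).powersetCard (k+3), ∏ i ∈ S, x i =
    fullP (gO x n k) (x (n+1)) (x (n+2)) (x (n+3)) (x (n+4)) (x (n+5)) (x (n+6)) := by
  have h : ∑ S ∈ (Icc 1 (n+k+6)).powersetCard (k+3), ∏ i ∈ S, x i
      = esZ x (Icc 1 (n+k+6)) ((k:ℤ)+3) := by
    unfold esZ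
    rw [if_neg (by omega)]
    have : ((k:ℤ)+3).toNat = k+3 := by omega
    rw [this]
  rw [h, Icc_eq]
  rw [esZ_insert]
  swap
  · simp [restO]
  repeat (rw [esZ_insert (i := n+2)]; swap; · simp [restO])
  repeat (rw [esZ_insert (i := n+3)]; swap; · simp [restO])
  repeat (rw [esZ_insert (i := n+4)]; swap; · simp [restO])
  repeat (rw [esZ_insert (i := n+5)]; swap; · simp [restO])
  repeat (rw [esZ_insert (i := n+6)]; swap; · simp [restO])
  simp only [sub_sub]
  norm_num
  unfold fullP gO
  norm_num
  ring

lemma gO_three (x : ℕ → ℝ) (hx : ∀ i, 0 ≤ x i) (n k : ℕ) : Vp x n k ≤ gO x n k 3 := by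
  unfold gO esZ Vp
  rw [if_neg (by push_cast; omega)]
  have : ((k:ℤ)+3-(3:ℕ)).toNat = k := by omega
  rw [this]
  refine single_le_sum (f := fun S => ∏ i ∈ S, x i) (fun S _ => prod_nonneg fun i _ => hx i) ?_
  rw [mem_powersetCard]
  refine ⟨subset_union_right, by simp⟩

/-- evaluation of the colex family -/
lemma evalA (y : ℕ → ℝ) (n k : ℕ) :
    lagEvalN ((Icc 1 (n+k+6)).powersetCard (k+3) \
          {Icc (n+4) (n+k+6),
           insert (n+3) (Icc (n+5) (n+k+6)),
           insert (n+2) (Icc (n+5) (n+k+6)),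
           insert (n+1) (Icc (n+5) (n+k+6))}) y =
    valA (gO y n k) (Vp y n k) (y (n+1)) (y (n+2)) (y (n+3)) (y (n+4)) (y (n+5)) (y (n+6)) := by
  have hI : Icc (n+4) (n+k+6) = insert (n+4) (Icc (n+5) (n+k+6)) := by
    ext i; simp only [mem_Icc, mem_insert]; omega
  have hN : ({Icc (n+4) (n+k+6), insert (n+3) (Icc (n+5) (n+k+6)),
           insert (n+2) (Icc (n+5) (n+k+6)), insert (n+1) (Icc (n+5) (n+k+6))} : Finset (Finset ℕ))
      = ({n+4, n+3, n+2, n+1} : Finset ℕ).image (fun i => insert i (Icc (n+5) (n+k+6))) := by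
    rw [hI]; simp [image_insert]
  have hB : ∏ i ∈ Icc (n+5) (n+k+6), y i = y (n+5) * (y (n+6) * Vp y n k) := by
    have e : Icc (n+5) (n+k+6) = insert (n+5) (insert (n+6) (Icc (n+7) (n+k+6))) := by
      ext i; simp only [mem_Icc, mem_insert]; omega
    rw [e, prod_insert (by simp), prod_insert (by simp), Vp]
  have hnot : ∀ i ∈ ({n+4, n+3, n+2, n+1} : Finset ℕ), i ∉ Icc (n+5) (n+k+6) := by
    intro i hi; simp only [mem_insert, mem_singleton] at hi; simp only [mem_Icc]; omega
  have hinj : Set.InjOn (fun i => insert i (Icc (n+5) (n+k+6)))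
      (({n+4, n+3, n+2, n+1} : Finset ℕ) : Set ℕ) := by
    intro i hi j hj hij
    have h1 : i ∈ insert j (Icc (n+5) (n+k+6)) := by
      have := mem_insert_self i (Icc (n+5) (n+k+6))
      simp only at hij
      rwa [hij] at this
    rcases mem_insert.1 h1 with h | h
    · exact h
    · exact absurd h (hnot i hi)
  have hsub : ({n+4, n+3, n+2, n+1} : Finset ℕ).image (fun i => insert i (Icc (n+5) (n+k+6))) ⊆
      (Icc 1 (n+k+6)).powersetCard (k+3) := by
    intro S hS
    obtain ⟨i, hi, rfl⟩ := mem_image.1 hS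
    rw [mem_powersetCard, card_insert_of_notMem (hnot i hi)]
    constructor
    · intro j hj
      simp only [mem_insert, mem_singleton, mem_Icc] at hi hj ⊢
      omega
    · simp only [Nat.card_Icc]; omega
  rw [hN]
  unfold lagEvalN
  have hs := sum_sdiff hsub (f := fun S => ∏ i ∈ S, y i)
  rw [full_eq, sum_image hinj] at hs
  have hsum : ∑ i ∈ ({n+4, n+3, n+2, n+1} : Finset ℕ), ∏ j ∈ insert i (Icc (n+5) (n+k+6)), y j
      = ∑ i ∈ ({n+4, n+3, n+2, n+1} : Finset ℕ), y i * (y (n+5) * (y (n+6) * Vp y n k)) := by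
    apply sum_congr rfl
    intro i hi
    rw [prod_insert (hnot i hi), hB]
  rw [hsum, sum_insert (by simp), sum_insert (by simp), sum_insert (by simp), sum_singleton] at hs
  unfold valA
  linarith

lemma lagEvalN_mono (E : Finset (Finset ℕ)) (x y : ℕ → ℝ) (hx : ∀ i, 0 ≤ x i)
    (hxy : ∀ i, x i ≤ y i) : lagEvalN E x ≤ lagEvalN E y :=
  sum_le_sum fun _ _ => prod_le_prod (fun i _ => hx i) fun i _ => hxy i

lemma bdd (E : Finset (Finset ℕ)) : BddAbove {v | ∃ x, IsLegalN x ∧ lagEvalN E x = v} := by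
  refine ⟨∑ _e ∈ E, 1, ?_⟩
  rintro v ⟨x, ⟨hx, s, hs, hsum⟩, rfl⟩
  refine sum_le_sum fun e _ => prod_le_one (fun i _ => hx i) fun i _ => ?_
  by_cases hi : i ∈ s
  · rw [← hsum]; exact single_le_sum (fun j _ => hx j) hi
  · rw [hs i hi]; exact zero_le_one

lemma le_lag {r : ℕ} (E : Finset (Finset ℕ)) (t : ℕ) (ht : 1 ≤ t)
    (hE : E ⊆ (Icc 1 t).powersetCard r) (y : ℕ → ℝ) (hy : ∀ i, 0 ≤ y i)
    (hs : ∑ i ∈ Icc 1 t, y i ≤ 1) : lagEvalN E y ≤ lagrangianN E := by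
  let z : ℕ → ℝ := fun i => if i ∈ Icc 1 t then y i + (if i = 1 then 1 - ∑ i ∈ Icc 1 t, y i else 0)
    else 0
  have hz0 : ∀ i, 0 ≤ z i := by
    intro i; simp only [z]
    have := hy i
    split_ifs <;> linarith
  have h1 : lagEvalN E y ≤ lagEvalN E z := by
    refine sum_le_sum fun S hS => prod_le_prod (fun i _ => hy i) fun i hi => ?_
    have : i ∈ Icc 1 t := (mem_powersetCard.1 (hE hS)).1 hi
    simp only [z, if_pos this]
    split_ifs <;> linarith
  refine h1.trans (le_csSup (bdd E) ⟨z, ⟨hz0, Icc 1 t, ?_, ?_⟩, rfl⟩)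
  · intro i hi; simp only [z, if_neg hi]
  · have : ∑ i ∈ Icc 1 t, z i
      = ∑ i ∈ Icc 1 t, (y i + (if i = 1 then 1 - ∑ i ∈ Icc 1 t, y i else 0)) :=
      sum_congr rfl fun i hi => by simp only [z, if_pos hi]
    rw [this, sum_add_distrib, sum_ite_eq' (Icc 1 t) 1, if_pos (by simp [ht])]
    ring

lemma topprod (x : ℕ → ℝ) (hx : ∀ i, 0 ≤ x i) (t p : ℕ)
    (hanti : ∀ i j, 1 ≤ i → i ≤ j → j ≤ t → x j ≤ x i) (hp : 1 ≤ p) (U : Finset ℕ)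
    (hU : U ⊆ Icc 1 t) (hc : U.card = t + 1 - p) :
    ∏ i ∈ Icc p t, x i ≤ ∏ i ∈ U, x i := by
  rcases lt_or_ge t p with h | h
  · have h0 : U.card = 0 := by omega
    rw [card_eq_zero] at h0
    subst h0
    rw [Icc_eq_empty (by omega)]
  have hcard : (Icc p t \ U).card = (U \ Icc p t).card := by
    have h1 := card_sdiff_add_card_inter (Icc p t) U
    have h2 := card_sdiff_add_card_inter U (Icc p t)
    rw [inter_comm] at h2
    have h3 : (Icc p t).card = t + 1 - p := by simp
    omega
  have e1 : ∏ i ∈ Icc p t, x i = (∏ i ∈ Icc p t \ U, x i) * ∏ i ∈ Icc p t ∩ U, x i := by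
    rw [← prod_union (disjoint_sdiff_inter _ _), sdiff_union_inter]
  have e2 : ∏ i ∈ U, x i = (∏ i ∈ U \ Icc p t, x i) * ∏ i ∈ Icc p t ∩ U, x i := by
    rw [inter_comm, ← prod_union (disjoint_sdiff_inter _ _), sdiff_union_inter]
  rw [e1, e2]
  refine mul_le_mul_of_nonneg_right ?_ (prod_nonneg fun i _ => hx i)
  calc ∏ i ∈ Icc p t \ U, x i ≤ ∏ i ∈ Icc p t \ U, x p := by
        refine prod_le_prod (fun i _ => hx i) fun i hi => ?_
        have := mem_Icc.1 (mem_sdiff.1 hi).1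
        exact hanti p i hp this.1 this.2
    _ = ∏ i ∈ U \ Icc p t, x p := by rw [prod_const, prod_const, hcard]
    _ ≤ ∏ i ∈ U \ Icc p t, x i := by
        refine prod_le_prod (fun i _ => hx p) fun i hi => ?_
        have h1 := mem_sdiff.1 hi
        have h2 := mem_Icc.1 (hU h1.1)
        have h3 := h1.2
        rw [mem_Icc] at h3
        exact hanti i p h2.1 (by omega) h

lemma peel (x : ℕ → ℝ) (hx : ∀ i, 0 ≤ x i) (t : ℕ)
    (hanti : ∀ i j, 1 ≤ i → i ≤ j → j ≤ t → x j ≤ x i) (S : Finset ℕ) (hS : S ⊆ Icc 1 t)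
    (j i : ℕ) (hj : j ∈ S) (hji : j ≤ i) (hit : i ≤ t) (P : ℝ) (hP : 0 ≤ P)
    (h : P ≤ ∏ l ∈ S.erase j, x l) : x i * P ≤ ∏ l ∈ S, x l := by
  rw [← mul_prod_erase S x hj]
  exact mul_le_mul (hanti j i (mem_Icc.1 (hS hj)).1 hji hit) h hP (hx j)

lemma exists_small (t p : ℕ) (U : Finset ℕ) (hU : U ⊆ Icc 1 t) (hc : U.card = t + 1 - p)
    (hne : U ≠ Icc p t) : ∃ j ∈ U, j < p := by
  by_contra hcon
  push Not at hcon
  apply hne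
  apply eq_of_subset_of_card_le
  · intro i hi
    exact mem_Icc.2 ⟨hcon i hi, (mem_Icc.1 (hU hi)).2⟩
  · simp [hc]

lemma prodIcc4 (x : ℕ → ℝ) (n k : ℕ) : ∏ i ∈ Icc (n+6) (n+k+6), x i = x (n+6) * Vp x n k := by
  have e : Icc (n+6) (n+k+6) = insert (n+6) (Icc (n+7) (n+k+6)) := by
    ext i; simp only [mem_Icc, mem_insert]; omega
  rw [e, prod_insert (by simp), Vp]

lemma prodIcc5 (x : ℕ → ℝ) (n k : ℕ) :
    ∏ i ∈ Icc (n+5) (n+k+6), x i = x (n+5) * (x (n+6) * Vp x n k) := by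
  have e : Icc (n+5) (n+k+6) = insert (n+5) (Icc (n+6) (n+k+6)) := by
    ext i; simp only [mem_Icc, mem_insert]; omega
  rw [e, prod_insert (by simp), prodIcc4]

lemma prodIcc6 (x : ℕ → ℝ) (n k : ℕ) :
    ∏ i ∈ Icc (n+4) (n+k+6), x i = x (n+4) * (x (n+5) * (x (n+6) * Vp x n k)) := by
  have e : Icc (n+4) (n+k+6) = insert (n+4) (Icc (n+5) (n+k+6)) := by
    ext i; simp only [mem_Icc, mem_insert]; omega
  rw [e, prod_insert (by simp), prodIcc5]

lemma lev0 (x : ℕ → ℝ) (hx : ∀ i, 0 ≤ x i) (n k : ℕ)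
    (hanti : ∀ i j, 1 ≤ i → i ≤ j → j ≤ n+k+6 → x j ≤ x i) (S : Finset ℕ)
    (hS : S ⊆ Icc 1 (n+k+6)) (hc : S.card = k+3) : x (n+4) * (x (n+5) * (x (n+6) * Vp x n k)) ≤ ∏ i ∈ S, x i := by
  rw [← prodIcc6]
  exact topprod x hx _ _ hanti (by omega) S hS (by omega)

lemma levj (x : ℕ → ℝ) (hx : ∀ i, 0 ≤ x i) (n k : ℕ)
    (hanti : ∀ i j, 1 ≤ i → i ≤ j → j ≤ n+k+6 → x j ≤ x i) (S : Finset ℕ)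
    (hS : S ⊆ Icc 1 (n+k+6)) (hc : S.card = k+3)
    (j i : ℕ) (hj : j ∈ S) (hji : j ≤ i) (hi : i ≤ n+k+6) :
    x i * (x (n+5) * (x (n+6) * Vp x n k)) ≤ ∏ l ∈ S, x l := by
  rw [← prodIcc5]
  refine peel x hx _ hanti S hS j i hj hji hi _ (prod_nonneg fun i _ => hx i) ?_
  exact topprod x hx _ _ hanti (by omega) _ ((erase_subset _ _).trans hS)
    (by rw [card_erase_of_mem hj]; omega)

lemma levjj (x : ℕ → ℝ) (hx : ∀ i, 0 ≤ x i) (n k : ℕ)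
    (hanti : ∀ i j, 1 ≤ i → i ≤ j → j ≤ n+k+6 → x j ≤ x i) (S : Finset ℕ)
    (hS : S ⊆ Icc 1 (n+k+6)) (hc : S.card = k+3)
    (j j' i i' : ℕ) (hj : j ∈ S) (hji : j ≤ i) (hi : i ≤ n+k+6)
    (hj' : j' ∈ S.erase j) (hji' : j' ≤ i') (hi' : i' ≤ n+k+6) :
    x i * (x i' * (x (n+6) * Vp x n k)) ≤ ∏ l ∈ S, x l := by
  rw [← prodIcc4]
  have h0 : 0 ≤ ∏ l ∈ Icc (n+6) (n+k+6), x l := prod_nonneg fun i _ => hx i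
  refine peel x hx _ hanti S hS j i hj hji hi _ (mul_nonneg (hx _) h0) ?_
  have hs' : S.erase j ⊆ Icc 1 (n+k+6) := (erase_subset _ _).trans hS
  refine peel x hx _ hanti _ hs' j' i' hj' hji' hi' _ h0 ?_
  exact topprod x hx _ _ hanti (by omega) _ ((erase_subset _ _).trans hs')
    (by rw [card_erase_of_mem hj', card_erase_of_mem hj]; omega)

lemma lev1 (x : ℕ → ℝ) (hx : ∀ i, 0 ≤ x i) (n k : ℕ)
    (hanti : ∀ i j, 1 ≤ i → i ≤ j → j ≤ n+k+6 → x j ≤ x i) (S : Finset ℕ)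
    (hS : S ⊆ Icc 1 (n+k+6)) (hc : S.card = k+3)
    (h0 : S ≠ Icc (n+4) (n+k+6)) :
    x (n+3) * (x (n+5) * (x (n+6) * Vp x n k)) ≤ ∏ i ∈ S, x i := by
  obtain ⟨j, hj, hlt⟩ := exists_small _ (n+4) S hS (by omega) h0
  exact levj x hx n k hanti S hS hc j (n+3) hj (by omega) (by omega)

lemma lev3 (x : ℕ → ℝ) (hx : ∀ i, 0 ≤ x i) (n k : ℕ)
    (hanti : ∀ i j, 1 ≤ i → i ≤ j → j ≤ n+k+6 → x j ≤ x i) (S : Finset ℕ)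
    (hS : S ⊆ Icc 1 (n+k+6)) (hc : S.card = k+3)
    (h0 : S ≠ Icc (n+4) (n+k+6)) (h1 : S ≠ insert (n+3) (Icc (n+5) (n+k+6))) :
    (S = insert (n+2) (Icc (n+5) (n+k+6)) ∧
      x (n+2) * (x (n+5) * (x (n+6) * Vp x n k)) ≤ ∏ i ∈ S, x i) ∨
    (S = insert (n+3) (insert (n+4) (Icc (n+6) (n+k+6))) ∧
      x (n+3) * (x (n+4) * (x (n+6) * Vp x n k)) ≤ ∏ i ∈ S, x i) ∨
    x (n+1) * (x (n+5) * (x (n+6) * Vp x n k)) ≤ ∏ i ∈ S, x i ∨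
    x (n+2) * (x (n+4) * (x (n+6) * Vp x n k)) ≤ ∏ i ∈ S, x i ∨
    x (n+3) * (x (n+4) * (x (n+5) * Vp x n k)) ≤ ∏ i ∈ S, x i := by
  by_cases ha : ∃ j ∈ S, j ≤ n+1
  · obtain ⟨j, hj, hle⟩ := ha
    right; right; left
    exact levj x hx n k hanti S hS hc j (n+1) hj hle (by omega)
  push Not at ha
  by_cases hb : n+2 ∈ S
  · have hs' : S.erase (n+2) ⊆ Icc 1 (n+k+6) := (erase_subset _ _).trans hS
    by_cases hE : S.erase (n+2) = Icc (n+5) (n+k+6)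
    · left
      refine ⟨by rw [← hE, insert_erase hb], ?_⟩
      exact levj x hx n k hanti S hS hc (n+2) (n+2) hb le_rfl (by omega)
    · obtain ⟨j, hj, hlt⟩ := exists_small _ (n+5) _ hs'
        (by rw [card_erase_of_mem hb]; omega) hE
      right; right; right; left
      exact levjj x hx n k hanti S hS hc (n+2) j (n+2) (n+4) hb le_rfl (by omega) hj (by omega)
        (by omega)
  have h3 : n+3 ∈ S := by
    obtain ⟨j, hj, hlt⟩ := exists_small _ (n+4) S hS (by omega) h0
    have := ha j hj
    have h2 : j ≠ n+2 := fun h => hb (h ▸ hj)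
    have : j = n+3 := by omega
    exact this ▸ hj
  have hs' : S.erase (n+3) ⊆ Icc 1 (n+k+6) := (erase_subset _ _).trans hS
  have hc' : (S.erase (n+3)).card = k+2 := by rw [card_erase_of_mem h3]; omega
  have h4 : n+4 ∈ S.erase (n+3) := by
    obtain ⟨j, hj, hlt⟩ := exists_small _ (n+5) _ hs' (by omega)
      (fun h => h1 (by rw [← h, insert_erase h3]))
    have hjS := mem_of_mem_erase hj
    have := ha j hjS
    have h2 : j ≠ n+2 := fun h => hb (h ▸ hjS)
    have h2' := ne_of_mem_erase hj
    have : j = n+4 := by omega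
    exact this ▸ hj
  have hs'' : (S.erase (n+3)).erase (n+4) ⊆ Icc 1 (n+k+6) := (erase_subset _ _).trans hs'
  have hc'' : ((S.erase (n+3)).erase (n+4)).card = k+1 := by rw [card_erase_of_mem h4]; omega
  by_cases hE : (S.erase (n+3)).erase (n+4) = Icc (n+6) (n+k+6)
  · right; left
    refine ⟨by rw [← hE, insert_erase h4, insert_erase h3], ?_⟩
    exact levjj x hx n k hanti S hS hc (n+3) (n+4) (n+3) (n+4) h3 le_rfl (by omega) h4 le_rfl
      (by omega)
  · obtain ⟨j, hj, hlt⟩ := exists_small _ (n+6) _ hs'' (by omega) hE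
    right; right; right; right
    have hV : 0 ≤ Vp x n k := prod_nonneg fun i _ => hx i
    refine peel x hx _ hanti S hS (n+3) (n+3) h3 le_rfl (by omega) _
      (mul_nonneg (hx _) (mul_nonneg (hx _) hV)) ?_
    refine peel x hx _ hanti _ hs' (n+4) (n+4) h4 le_rfl (by omega) _ (mul_nonneg (hx _) hV) ?_
    refine peel x hx _ hanti _ hs'' j (n+5) hj (by omega) (by omega) _ hV ?_
    exact topprod x hx _ _ hanti (by omega) _ ((erase_subset _ _).trans hs'')
      (by rw [card_erase_of_mem hj]; omega)


lemma sum_dom (x : ℕ → ℝ) (hx : ∀ i, 0 ≤ x i) (n k : ℕ)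
    (hanti : ∀ i j, 1 ≤ i → i ≤ j → j ≤ n+k+6 → x j ≤ x i) (N : Finset (Finset ℕ))
    (hN : N ⊆ (Icc 1 (n+k+6)).powersetCard (k+3)) (hc : N.card = 4) :
    Vp x n k * x (n+6) * x (n+5) * (x (n+1) + x (n+2) + x (n+3) + x (n+4)) ≤
      ∑ S ∈ N, ∏ i ∈ S, x i ∨
    Vp x n k * x (n+6) * (x (n+5) * (x (n+2) + x (n+3) + x (n+4)) + x (n+3) * x (n+4)) ≤
      ∑ S ∈ N, ∏ i ∈ S, x i ∨
    Vp x n k * (x (n+4) * x (n+5) * x (n+6) + x (n+3) * x (n+5) * x (n+6)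
      + x (n+3) * x (n+4) * x (n+6) + x (n+3) * x (n+4) * x (n+5)) ≤
      ∑ S ∈ N, ∏ i ∈ S, x i := by
  have hM : 2 ≤ (N \ {Icc (n+4) (n+k+6), insert (n+3) (Icc (n+5) (n+k+6))}).card := by
    have h1 := le_card_sdiff {Icc (n+4) (n+k+6), insert (n+3) (Icc (n+5) (n+k+6))} N
    have h2 := card_le_two (a := Icc (n+4) (n+k+6)) (b := insert (n+3) (Icc (n+5) (n+k+6)))
    omega
  obtain ⟨S, hS, T, hT, hST⟩ := one_lt_card.1 hM
  simp only [mem_sdiff, mem_insert, mem_singleton, not_or] at hS hT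
  obtain ⟨hSN, hS0, hS1⟩ := hS
  obtain ⟨hTN, hT0, hT1⟩ := hT
  have hTN' : T ∈ N.erase S := mem_erase.2 ⟨hST.symm, hTN⟩
  have hcR : ((N.erase S).erase T).card = 2 := by
    rw [card_erase_of_mem hTN', card_erase_of_mem hSN]; omega
  obtain ⟨U, W, hUW, hR⟩ := card_eq_two.1 hcR
  have hUN : U ∈ N := by
    have : U ∈ (N.erase S).erase T := by rw [hR]; simp
    exact mem_of_mem_erase (mem_of_mem_erase this)
  have hWN : W ∈ N := by
    have : W ∈ (N.erase S).erase T := by rw [hR]; simp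
    exact mem_of_mem_erase (mem_of_mem_erase this)
  have hsum : ∑ S ∈ N, ∏ i ∈ S, x i = ∏ i ∈ S, x i + (∏ i ∈ T, x i +
      (∏ i ∈ U, x i + ∏ i ∈ W, x i)) := by
    rw [← add_sum_erase N _ hSN, ← add_sum_erase _ _ hTN', hR, sum_pair hUW]
  rw [hsum]
  have pS := mem_powersetCard.1 (hN hSN)
  have pT := mem_powersetCard.1 (hN hTN)
  have pU := mem_powersetCard.1 (hN hUN)
  have pW := mem_powersetCard.1 (hN hWN)
  have hUWs : x (n+4) * (x (n+5) * (x (n+6) * Vp x n k)) +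
      x (n+3) * (x (n+5) * (x (n+6) * Vp x n k)) ≤ ∏ i ∈ U, x i + ∏ i ∈ W, x i := by
    have u0 := lev0 x hx n k hanti U pU.1 pU.2
    have w0 := lev0 x hx n k hanti W pW.1 pW.2
    by_cases hU0 : U = Icc (n+4) (n+k+6)
    · have := lev1 x hx n k hanti W pW.1 pW.2 (fun h => hUW (hU0.trans h.symm))
      linarith
    · have := lev1 x hx n k hanti U pU.1 pU.2 hU0
      linarith
  have hV : 0 ≤ Vp x n k := prod_nonneg fun i _ => hx i
  have a1 : x (n+2) ≤ x (n+1) := hanti _ _ (by omega) (by omega) (by omega)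
  have a2 : x (n+3) ≤ x (n+2) := hanti _ _ (by omega) (by omega) (by omega)
  have a4 : x (n+5) ≤ x (n+4) := hanti _ _ (by omega) (by omega) (by omega)
  have a5 : x (n+6) ≤ x (n+5) := hanti _ _ (by omega) (by omega) (by omega)
  have hfV : 0 ≤ x (n+6) * Vp x n k := mul_nonneg (hx _) hV
  have f1 : x (n+2) * (x (n+5) * (x (n+6) * Vp x n k))
      ≤ x (n+1) * (x (n+5) * (x (n+6) * Vp x n k)) :=
    mul_le_mul_of_nonneg_right a1 (mul_nonneg (hx _) hfV)
  have f2 : x (n+3) * (x (n+4) * (x (n+6) * Vp x n k))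
      ≤ x (n+2) * (x (n+4) * (x (n+6) * Vp x n k)) :=
    mul_le_mul_of_nonneg_right a2 (mul_nonneg (hx _) hfV)
  have f3 : x (n+3) * (x (n+4) * (x (n+6) * Vp x n k))
      ≤ x (n+3) * (x (n+4) * (x (n+5) * Vp x n k)) :=
    mul_le_mul_of_nonneg_left (mul_le_mul_of_nonneg_left
      (mul_le_mul_of_nonneg_right a5 hV) (hx _)) (hx _)
  have f4 : x (n+2) * (x (n+5) * (x (n+6) * Vp x n k))
      ≤ x (n+2) * (x (n+4) * (x (n+6) * Vp x n k)) :=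
    mul_le_mul_of_nonneg_left (mul_le_mul_of_nonneg_right a4 hfV) (hx _)
  have key : x (n+1) * (x (n+5) * (x (n+6) * Vp x n k))
        + x (n+2) * (x (n+5) * (x (n+6) * Vp x n k)) ≤ ∏ i ∈ S, x i + ∏ i ∈ T, x i ∨
      x (n+2) * (x (n+5) * (x (n+6) * Vp x n k))
        + x (n+3) * (x (n+4) * (x (n+6) * Vp x n k)) ≤ ∏ i ∈ S, x i + ∏ i ∈ T, x i ∨
      x (n+3) * (x (n+4) * (x (n+6) * Vp x n k))
        + x (n+3) * (x (n+4) * (x (n+5) * Vp x n k)) ≤ ∏ i ∈ S, x i + ∏ i ∈ T, x i := by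
    rcases lev3 x hx n k hanti S pS.1 pS.2 hS0 hS1 with ⟨e, h⟩ | ⟨e, h⟩ | h | h | h <;>
    rcases lev3 x hx n k hanti T pT.1 pT.2 hT0 hT1 with ⟨e', h'⟩ | ⟨e', h'⟩ | h' | h' | h' <;>
    first
    | (exfalso; exact hST (e.trans e'.symm))
    | (left; linarith)
    | (right; left; linarith)
    | (right; right; linarith)
  rcases key with h | h | h
  · left; linarith
  · right; left; linarith
  · right; right; linarith

/-- The colex family in shifted coordinates. -/
def colexF (n k : ℕ) : Finset (Finset ℕ) :=
  (Icc 1 (n+k+6)).powersetCard (k+3) \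
          {Icc (n+4) (n+k+6),
           insert (n+3) (Icc (n+5) (n+k+6)),
           insert (n+2) (Icc (n+5) (n+k+6)),
           insert (n+1) (Icc (n+5) (n+k+6))}

lemma valA_le_lag (x : ℕ → ℝ) (hx : ∀ i, 0 ≤ x i) (n k : ℕ)
    (hs : ∑ i ∈ Icc 1 (n+k+6), x i ≤ 1) (a b c d e f : ℝ) (ha : 0 ≤ a) (hb : 0 ≤ b) (hc : 0 ≤ c)
    (hd : 0 ≤ d) (he : 0 ≤ e) (hf : 0 ≤ f)
    (hsum : a + b + c + d + e + f
      = x (n+1) + x (n+2) + x (n+3) + x (n+4) + x (n+5) + x (n+6)) :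
    valA (gO x n k) (Vp x n k) a b c d e f ≤ lagrangianN (colexF n k) := by
  obtain ⟨y, hy⟩ : ∃ y : ℕ → ℝ, y = fun i => if i = n+1 then a else if i = n+2 then b else
    if i = n+3 then c else if i = n+4 then d else if i = n+5 then e else
    if i = n+6 then f else x i := ⟨_, rfl⟩
  have y1 : y (n+1) = a := by simp [hy]
  have y2 : y (n+2) = b := by simp [hy]
  have y3 : y (n+3) = c := by simp [hy]
  have y4 : y (n+4) = d := by simp [hy]
  have y5 : y (n+5) = e := by simp [hy]
  have y6 : y (n+6) = f := by simp [hy]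
  have yo : ∀ i, (i < n+1 ∨ n+6 < i) → y i = x i := by
    intro i hi
    simp only [hy]
    rw [if_neg (by omega), if_neg (by omega), if_neg (by omega), if_neg (by omega),
      if_neg (by omega), if_neg (by omega)]
  have yr : ∀ i ∈ restO n k, y i = x i := by
    intro i hi
    apply yo
    simp only [restO, mem_union, mem_Icc] at hi
    omega
  have y0 : ∀ i, 0 ≤ y i := by
    intro i
    have := hx i
    simp only [hy]
    split_ifs <;> assumption
  have hg : gO y n k = gO x n k := by
    funext j; exact esZ_congr y x _ yr _
  have hV : Vp y n k = Vp x n k := by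
    refine prod_congr rfl fun i hi => yo i ?_
    have := mem_Icc.1 hi
    omega
  have hexp : ∀ z : ℕ → ℝ, ∑ i ∈ Icc 1 (n+k+6), z i = z (n+1) + (z (n+2) + (z (n+3) + (z (n+4)
      + (z (n+5) + (z (n+6) + ∑ i ∈ restO n k, z i))))) := by
    intro z
    rw [Icc_eq, sum_insert (by simp [restO]), sum_insert (by simp [restO]),
      sum_insert (by simp [restO]), sum_insert (by simp [restO]), sum_insert (by simp [restO]),
      sum_insert (by simp [restO])]
  have hsy : ∑ i ∈ Icc 1 (n+k+6), y i ≤ 1 := by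
    rw [hexp] at hs ⊢
    rw [sum_congr rfl yr, y1, y2, y3, y4, y5, y6]
    linarith
  have h := evalA y n k
  rw [hg, hV, y1, y2, y3, y4, y5, y6] at h
  rw [← h]
  exact le_lag (colexF n k) (n+k+6) (by omega) sdiff_subset y y0 hsy

lemma main_sorted (x : ℕ → ℝ) (hx : ∀ i, 0 ≤ x i) (n k : ℕ)
    (hanti : ∀ i j, 1 ≤ i → i ≤ j → j ≤ n+k+6 → x j ≤ x i)
    (hs : ∑ i ∈ Icc 1 (n+k+6), x i ≤ 1) (E : Finset (Finset ℕ))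
    (hE : E ⊆ (Icc 1 (n+k+6)).powersetCard (k+3))
    (hc : ((Icc 1 (n+k+6)).powersetCard (k+3) \ E).card = 4) :
    lagEvalN E x ≤ lagrangianN (colexF n k) := by
  have hsplit := sum_sdiff hE (f := fun S => ∏ i ∈ S, x i)
  rw [full_eq] at hsplit
  have hV0 : 0 ≤ Vp x n k := prod_nonneg fun i _ => hx i
  have hg0 : ∀ j, 0 ≤ gO x n k j := fun j => esZ_nonneg x hx _ _
  have hg3 := gO_three x hx n k
  have a1 : x (n+2) ≤ x (n+1) := hanti _ _ (by omega) (by omega) (by omega)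
  have a2 : x (n+3) ≤ x (n+2) := hanti _ _ (by omega) (by omega) (by omega)
  have a3 : x (n+4) ≤ x (n+3) := hanti _ _ (by omega) (by omega) (by omega)
  have a4 : x (n+5) ≤ x (n+4) := hanti _ _ (by omega) (by omega) (by omega)
  have a5 : x (n+6) ≤ x (n+5) := hanti _ _ (by omega) (by omega) (by omega)
  have hself := valA_le_lag x hx n k hs _ _ _ _ _ _ (hx (n+1)) (hx (n+2)) (hx (n+3)) (hx (n+4))
    (hx (n+5)) (hx (n+6)) rfl
  rcases sum_dom x hx n k hanti _ sdiff_subset hc with h | h | h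
  · refine le_trans ?_ hself
    unfold lagEvalN valA
    linarith
  · have h1 : lagEvalN E x ≤ valB (gO x n k) (Vp x n k) (x (n+1)) (x (n+2)) (x (n+3)) (x (n+4))
        (x (n+5)) (x (n+6)) := by
      unfold lagEvalN valB
      linarith
    refine h1.trans ?_
    rcases hV0.eq_or_lt with hV | hV
    · refine le_trans (le_of_eq ?_) hself
      unfold valA valB
      rw [← hV]; ring
    rcases (hx (n+6)).eq_or_lt with hf | hf
    · refine le_trans (le_of_eq ?_) hself
      unfold valA valB
      rw [← hf]; ring
    obtain ⟨a', b', c', d', e', f', ha, hb, hc, hd, he, hf', hsum, hle⟩ :=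
      lemB (gO x n k) (Vp x n k) _ _ _ _ _ _ hg0 hV hg3 a1 a2 a3 a4 a5 hf
    exact hle.trans (valA_le_lag x hx n k hs _ _ _ _ _ _ ha hb hc hd he hf' hsum)
  · have h1 : lagEvalN E x ≤ valC (gO x n k) (Vp x n k) (x (n+1)) (x (n+2)) (x (n+3)) (x (n+4))
        (x (n+5)) (x (n+6)) := by
      unfold lagEvalN valC
      linarith
    refine h1.trans ?_
    rcases hV0.eq_or_lt with hV | hV
    · refine le_trans (le_of_eq ?_) hself
      unfold valA valC
      rw [← hV]; ring
    obtain ⟨a', b', c', d', e', f', ha, hb, hc, hd, he, hf', hsum, hle⟩ :=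
      lemC (gO x n k) (Vp x n k) _ _ _ _ _ _ hg0 hV hg3 a1 a2 a3 a4 a5 (hx _)
    exact hle.trans (valA_le_lag x hx n k hs _ _ _ _ _ _ ha hb hc hd he hf' hsum)

/-- `Fin t` is `{1, …, t}`. -/
def finIcc (t : ℕ) : Fin t ≃ {i : ℕ // i ∈ Icc 1 t} where
  toFun i := ⟨i.1 + 1, by rw [mem_Icc]; omega⟩
  invFun j := ⟨j.1 - 1, by have := mem_Icc.1 j.2; omega⟩
  left_inv i := by ext; simp
  right_inv j := by
    have := mem_Icc.1 j.2
    ext; simp only; omega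

lemma exists_sort (x : ℕ → ℝ) (t : ℕ) : ∃ σ : Equiv.Perm ℕ, (∀ i, i ∈ Icc 1 t ↔ σ i ∈ Icc 1 t) ∧
    ∀ i j, 1 ≤ i → i ≤ j → j ≤ t → x (σ j) ≤ x (σ i) := by
  let z : Fin t → ℝ := fun i => - x (finIcc t i)
  have hm : Monotone (z ∘ Tuple.sort z) := Tuple.monotone_sort z
  refine ⟨(Tuple.sort z).extendDomain (finIcc t), ?_, ?_⟩
  · intro i
    by_cases hi : i ∈ Icc 1 t
    · rw [Equiv.Perm.extendDomain_apply_subtype _ _ hi]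
      exact ⟨fun _ => Subtype.prop _, fun _ => hi⟩
    · rw [Equiv.Perm.extendDomain_apply_not_subtype _ _ hi]
  · intro i j hi hij hj
    have hi' : i ∈ Icc 1 t := mem_Icc.2 ⟨hi, by omega⟩
    have hj' : j ∈ Icc 1 t := mem_Icc.2 ⟨by omega, hj⟩
    rw [Equiv.Perm.extendDomain_apply_subtype _ _ hi', Equiv.Perm.extendDomain_apply_subtype _ _ hj']
    have hle : (finIcc t).symm ⟨i, hi'⟩ ≤ (finIcc t).symm ⟨j, hj'⟩ := by
      rw [Fin.le_def]
      simp only [finIcc, Equiv.coe_fn_symm_mk]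
      omega
    have := hm hle
    simp only [Function.comp_apply, z] at this
    linarith

lemma main_unsorted (x : ℕ → ℝ) (hx : ∀ i, 0 ≤ x i) (n k : ℕ)
    (hs : ∑ i ∈ Icc 1 (n+k+6), x i ≤ 1) (E : Finset (Finset ℕ))
    (hE : E ⊆ (Icc 1 (n+k+6)).powersetCard (k+3))
    (hc : E.card + 4 = (n+k+6).choose (k+3)) :
    lagEvalN E x ≤ lagrangianN (colexF n k) := by
  obtain ⟨σ, hσ, hanti⟩ := exists_sort x (n+k+6)
  have hE' : E.map (mapEmbedding σ.symm.toEmbedding).toEmbedding ⊆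
      (Icc 1 (n+k+6)).powersetCard (k+3) := by
    intro S hS
    obtain ⟨T, hT, rfl⟩ := mem_map.1 hS
    have := mem_powersetCard.1 (hE hT)
    simp only [RelEmbedding.coe_toEmbedding, mapEmbedding_apply]
    rw [mem_powersetCard, card_map]
    refine ⟨?_, this.2⟩
    intro i hi
    obtain ⟨j, hj, rfl⟩ := mem_map.1 hi
    rw [hσ]
    simpa using this.1 hj
  have hev : lagEvalN (E.map (mapEmbedding σ.symm.toEmbedding).toEmbedding) (fun i => x (σ i))
      = lagEvalN E x := by
    unfold lagEvalN
    rw [sum_map]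
    refine sum_congr rfl fun S _ => ?_
    simp only [RelEmbedding.coe_toEmbedding, mapEmbedding_apply]
    rw [prod_map]
    simp
  have hss : ∑ i ∈ Icc 1 (n+k+6), x (σ i) = ∑ i ∈ Icc 1 (n+k+6), x i :=
    sum_equiv σ hσ fun _ _ => rfl
  rw [← hev]
  refine main_sorted (fun i => x (σ i)) (fun i => hx _) n k hanti (by rw [hss]; exact hs) _ hE' ?_
  rw [card_sdiff_of_subset hE', card_map, card_powersetCard, Nat.card_Icc, Nat.add_sub_cancel, ← hc]
  omega

theorem colex_first_max_choose_sub_four {t r : ℕ} (hr : 3 ≤ r) (ht : r + 3 ≤ t) :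
    ∀ E : Finset (Finset ℕ), E ⊆ (Finset.Icc 1 t).powersetCard r →
      E.card = t.choose r - 4 →
      lagrangianN E ≤
        lagrangianN ((Finset.Icc 1 t).powersetCard r \
          {Finset.Icc (t - r + 1) t,
           insert (t - r) (Finset.Icc (t - r + 2) t),
           insert (t - r - 1) (Finset.Icc (t - r + 2) t),
           insert (t - r - 2) (Finset.Icc (t - r + 2) t)}) := by
  intro E hE hc
  obtain ⟨k, rfl⟩ : ∃ k, r = k + 3 := ⟨r - 3, by omega⟩
  obtain ⟨n, rfl⟩ : ∃ n, t = n + k + 6 := ⟨t - k - 6, by omega⟩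
  have e0 : n + k + 6 - (k + 3) = n + 3 := by omega
  rw [e0]
  change lagrangianN E ≤ lagrangianN (colexF n k)
  have h20 : 4 ≤ (n+k+6).choose (k+3) := by
    have h1 : (k+6).choose (k+3) ≤ (n+k+6).choose (k+3) := Nat.choose_le_choose _ (by omega)
    have h2 : (k+6).choose (k+3) = (k+6).choose 3 := by
      rw [← Nat.choose_symm (by omega : 3 ≤ k+6)]
      congr 1
    have h3 : Nat.choose 6 3 ≤ (k+6).choose 3 := Nat.choose_le_choose _ (by omega)
    have h4 : Nat.choose 6 3 = 20 := by decide
    omega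
  refine csSup_le ?_ ?_
  · refine ⟨_, fun i => if i = 1 then 1 else 0, ⟨?_, {1}, ?_, ?_⟩, rfl⟩
    · intro i; dsimp only; split_ifs <;> norm_num
    · intro i hi; simpa using hi
    · simp
  · rintro v ⟨x, ⟨hx, s, hs, hsum⟩, rfl⟩
    refine main_unsorted x hx n k ?_ E hE (by omega)
    rw [← hsum, ← sum_inter_add_sum_sdiff (Icc 1 (n+k+6)) s]
    have h0 : ∑ i ∈ Icc 1 (n+k+6) \ s, x i = 0 :=
      sum_eq_zero fun i hi => hs i (mem_sdiff.1 hi).2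
    rw [h0, add_zero]
    exact sum_le_sum_of_subset_of_nonneg inter_subset_right fun i _ _ => hx i
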